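/- Let u, v, w, x be natural numbers with 1 ≤ u ≤ v ≤ w ≤ x. If a(u,v) = a(v,w) and a(u,v) > 0, then c(u,x) ≥ c(u,v) + 1. (Indeed, A_{a(u,v)}(b(u,v) + 1) ≤ x, so either the level a(u,x) exceeds a(u,v) or the index b(u,x) exceeds b(u,v).) -/

import Mathlib

/-- Ackermann's function: `A 0 n = n + 1`, `A (k+1) 0 = A k 1`,
`A (k+1) (n+1) = A k (A (k+1) n)`. -/
def A : ℕ → ℕ → ℕ := ack

/-- The level `a(r, s) = min {k ≥ 0 | A k r > s}`. -/
noncomputable def lvl (r s : ℕ) : ℕ := sInf {k : ℕ | s < A k r}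

/-- The index `b(r, s) = max {i ≥ 0 | A (a(r,s)) i ≤ s}`. -/
noncomputable def idx (r s : ℕ) : ℕ := sSup {i : ℕ | A (lvl r s) i ≤ s}

/-- The count `c(r, s) = r · a(r,s) + b(r,s)`. -/
noncomputable def cnt (r s : ℕ) : ℕ := r * lvl r s + idx r s

theorem lt_A_lvl (r s : ℕ) : s < A (lvl r s) r :=
  Nat.sInf_mem (s := {k : ℕ | s < A k r}) ⟨s, lt_ack_left s r⟩

theorem A_le_of_lt_lvl {r s k : ℕ} (h : k < lvl r s) : A k r ≤ s :=
  not_lt.mp (Nat.notMem_of_lt_sInf (s := {k : ℕ | s < A k r}) h)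

theorem lvl_mono_right (r : ℕ) {s t : ℕ} (h : s ≤ t) : lvl r s ≤ lvl r t :=
  Nat.sInf_le (s := {k : ℕ | s < A k r}) (h.trans_lt (lt_A_lvl r t))

theorem bddAbove_setOf_A_le (k s : ℕ) : BddAbove {i : ℕ | A k i ≤ s} :=
  ⟨s, fun i hi => (lt_ack_right k i).le.trans hi⟩

theorem le_idx {r s i : ℕ} (h : A (lvl r s) i ≤ s) : i ≤ idx r s :=
  le_csSup (bddAbove_setOf_A_le (lvl r s) s) h

theorem A_idx_le {r s : ℕ} (hr : 1 ≤ r) (h : 0 < lvl r s) : A (lvl r s) (idx r s) ≤ s := by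
  refine Nat.sSup_mem (s := {i : ℕ | A (lvl r s) i ≤ s}) ⟨0, ?_⟩ (bddAbove_setOf_A_le _ s)
  obtain ⟨k, hk⟩ := Nat.exists_eq_succ_of_ne_zero h.ne'
  have hks : A k r ≤ s := A_le_of_lt_lvl (by omega)
  change A (lvl r s) 0 ≤ s
  rw [hk]
  exact (ack_succ_zero k).trans_le ((ack_mono_right k hr).trans hks)

theorem idx_lt {r s : ℕ} (hr : 1 ≤ r) (h : 0 < lvl r s) : idx r s < r :=
  ack_lt_iff_right.mp ((A_idx_le hr h).trans_lt (lt_A_lvl r s))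

theorem A_idx_succ_le {u v w : ℕ} (hu : 1 ≤ u) (heq : lvl u v = lvl v w) (hpos : 0 < lvl u v) :
    A (lvl u v) (idx u v + 1) ≤ w := by
  have hb := A_idx_le hu hpos
  obtain ⟨k, hk⟩ := Nat.exists_eq_succ_of_ne_zero hpos.ne'
  have hkw : A k v ≤ w := A_le_of_lt_lvl (by omega)
  rw [hk] at hb ⊢
  exact (ack_succ_succ k _).trans_le ((ack_mono_right k hb).trans hkw)

/-- For `1 ≤ u ≤ v ≤ w ≤ x`, if `a(u,v) = a(v,w)` and `a(u,v) > 0`, then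
`c(u,x) ≥ c(u,v) + 1`. -/
theorem equal_levels_increase_count (u v w x : ℕ)
    (hu : 1 ≤ u) (huv : u ≤ v) (hvw : v ≤ w) (hwx : w ≤ x)
    (heq : lvl u v = lvl v w) (hpos : 0 < lvl u v) :
    cnt u v + 1 ≤ cnt u x := by
  rcases (lvl_mono_right u (hvw.trans hwx)).eq_or_lt with h | h
  · have hi : idx u v + 1 ≤ idx u x :=
      le_idx (h ▸ (A_idx_succ_le hu heq hpos).trans hwx)
    rw [cnt, cnt, ← h]
    omega
  · have hb := idx_lt hu hpos
    have hm := Nat.mul_le_mul_left u (Nat.succ_le_of_lt h)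
    rw [Nat.mul_succ] at hm
    rw [cnt, cnt]
    omega
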